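/- arXiv:2003.05157 — 2 statements merged into one kernel-verified Lean document; each statement's English description precedes it below -/
import Mathlib

section
/- Let Y₁ ~ IG(μφ) and Y₂ ~ IG((1−μ)φ) be independent, let Z = Y₁/(Y₁+Y₂) and W = Y₁+Y₂. Then the conditional distribution of W given Z = z is the generalized inverse-Gaussian distribution GIG(1, φ² ζ_μ(z)², −1); i.e., the conditional density is f(w|z) = (φ ζ_μ(z) / (2 K_{−1}(φ ζ_μ(z)))) w^{−2} exp{−(1/2)[(φ²/w)(μ²/z + (1−μ)²/(1−z)) + w]} for w > 0. -/
open MeasureTheory ProbabilityTheory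

/-- Density of the inverse-Gaussian distribution IG(α) with scale 1. -/
noncomputable def igPdf (α y : ℝ) : ℝ :=
  α / Real.sqrt (2 * Real.pi) * y ^ (-(3 : ℝ) / 2) *
    Real.exp (-(1 / 2) * (α ^ 2 / y + y) + α)

/-- Modified Bessel function of the third kind (integral representation). -/
noncomputable def besselK (ν x : ℝ) : ℝ :=
  (1 / 2) * ∫ u in Set.Ioi (0 : ℝ), u ^ (ν - 1) * Real.exp (-(x / 2) * (u + u⁻¹))

noncomputable def zeta (μ z : ℝ) : ℝ :=
  Real.sqrt (1 + (z - μ) ^ 2 / (z * (1 - z)))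

/-- Density of the generalized inverse-Gaussian distribution GIG(a, b, s). -/
noncomputable def gigPdf (a b s u : ℝ) : ℝ :=
  (a / b) ^ (s / 2) / (2 * besselK s (Real.sqrt (a * b))) * u ^ (s - 1) *
    Real.exp (-(1 / 2) * (a * u + b / u))

/-- If `(Z, W)` has joint density `A z * h z w` and `h z` is a probability density wherever `A` does
not vanish, then `h z` is the conditional density of `W` given `Z = z`. -/
lemma condDistrib_ae_eq_withDensity {Ω : Type*} [MeasurableSpace Ω]
    (P : Measure Ω) [IsFiniteMeasure P] {Z W : Ω → ℝ} (hZ : Measurable Z) (hW : Measurable W)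
    {A : ℝ → ENNReal} (hA : Measurable A)
    {h : ℝ → ℝ → ENNReal} (hh : Measurable (Function.uncurry h))
    (hone : ∀ z, A z ≠ 0 → ∫⁻ w, h z w = 1)
    (hjoint : P.map (fun ω => (Z ω, W ω)) =
      ((volume : Measure ℝ).prod volume).withDensity fun p => A p.1 * h p.1 p.2) :
    ∀ᵐ z ∂(P.map Z), condDistrib W Z P z = volume.withDensity (h z) := by
  have hmap : P.map Z = volume.withDensity A := by
    refine Measure.ext_of_lintegral _ fun g hg => ?_
    have h1 : ∫⁻ z, g z ∂(P.map Z) = ∫⁻ p, g p.1 ∂(P.map (fun ω => (Z ω, W ω))) := by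
      rw [lintegral_map hg hZ, lintegral_map (by fun_prop) (by fun_prop)]
    rw [h1, hjoint, lintegral_withDensity_eq_lintegral_mul _ (by fun_prop) (by fun_prop),
      lintegral_withDensity_eq_lintegral_mul _ hA hg, lintegral_prod _ (by fun_prop)]
    refine lintegral_congr fun z => ?_
    simp only [Pi.mul_apply]
    rw [lintegral_mul_const _ (by fun_prop), lintegral_const_mul _ (by fun_prop)]
    by_cases hz : A z = 0
    · simp [hz]
    · rw [hone z hz, mul_one]
  have hS : MeasurableSet {z | A z ≠ 0} := (hA (measurableSet_singleton 0)).compl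
  set k : ℝ → ℝ → ENNReal := fun z w => {z | A z ≠ 0}.indicator (fun z => h z w) z with hk
  have hkm : Measurable (Function.uncurry k) :=
    hh.indicator (measurable_fst hS)
  set κ : Kernel ℝ ℝ := (Kernel.const ℝ (volume : Measure ℝ)).withDensity k with hκ
  have hκz (z : ℝ) : κ z = volume.withDensity (k z) := by
    rw [hκ, Kernel.withDensity_apply _ hkm, Kernel.const_apply]
  have hkz (z : ℝ) (hz : A z ≠ 0) : k z = h z := by
    funext w; simp [hk, hz]
  have hfin : IsFiniteKernel κ := by
    refine ⟨⟨1, ENNReal.one_lt_top, fun z => ?_⟩⟩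
    rw [hκz, withDensity_apply _ MeasurableSet.univ, Measure.restrict_univ]
    by_cases hz : A z = 0
    · simp [hk, hz]
    · rw [hkz z hz, hone z hz]
  have hcomp : P.map (fun ω => (Z ω, W ω)) = P.map Z ⊗ₘ κ := by
    refine Measure.ext_of_lintegral _ fun g hg => ?_
    rw [hjoint, Measure.lintegral_compProd hg, hmap,
      lintegral_withDensity_eq_lintegral_mul _ (by fun_prop) hg,
      lintegral_withDensity_eq_lintegral_mul _ hA hg.lintegral_kernel_prod_right',
      lintegral_prod _ (by fun_prop)]
    refine lintegral_congr fun z => ?_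
    simp only [Pi.mul_apply]
    by_cases hz : A z = 0
    · simp [hz]
    · rw [hκz, hkz z hz, lintegral_withDensity_eq_lintegral_mul _ (by fun_prop) (by fun_prop),
        ← lintegral_const_mul _ (by fun_prop)]
      simp only [Pi.mul_apply, mul_assoc]
  filter_upwards [condDistrib_ae_eq_of_measure_eq_compProd Z hW.aemeasurable hcomp,
    hmap ▸ (ae_withDensity_iff hA).2 (Filter.Eventually.of_forall fun z hz => hz)] with z h1 h2
  rw [h1, hκz, hkz z h2]

/-- Joint density of the ratio `X / (X + Y)` and the sum `X + Y` of independent positive `X`, `Y`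
with densities `f₁`, `f₂`. -/
lemma map_ratio_sum_withDensity {f₁ f₂ : ℝ → ENNReal} (hf₁ : Measurable f₁) (hf₂ : Measurable f₂)
    (h₁ : ∀ y ≤ 0, f₁ y = 0) (h₂ : ∀ y ≤ 0, f₂ y = 0) :
    ((volume.withDensity f₁).prod (volume.withDensity f₂)).map
        (fun p : ℝ × ℝ => (p.1 / (p.1 + p.2), p.1 + p.2)) =
      ((volume : Measure ℝ).prod volume).withDensity fun p =>
        ENNReal.ofReal p.2 * (f₁ (p.1 * p.2) * f₂ ((1 - p.1) * p.2)) := by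
  refine Measure.ext_of_lintegral _ fun g hg => ?_
  rw [lintegral_map hg (by fun_prop), prod_withDensity hf₁ hf₂,
    lintegral_withDensity_eq_lintegral_mul _ (by fun_prop) (by fun_prop),
    lintegral_withDensity_eq_lintegral_mul _ (by fun_prop) hg,
    lintegral_prod _ (by fun_prop), lintegral_prod_symm _ (by fun_prop)]
  simp only [Pi.mul_apply]
  have hshift (x : ℝ) : ∫⁻ y, f₁ x * f₂ y * g (x / (x + y), x + y) =
      ∫⁻ w, f₁ x * f₂ (w - x) * g (x / w, w) := by
    rw [← lintegral_add_left_eq_self (fun w => f₁ x * f₂ (w - x) * g (x / w, w)) x]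
    simp
  simp_rw [hshift]
  rw [lintegral_lintegral_swap (by fun_prop)]
  refine lintegral_congr fun w => ?_
  rcases le_or_gt w 0 with hw | hw
  · have hz (x : ℝ) : f₁ x * f₂ (w - x) = 0 := by
      rcases le_or_gt x 0 with hx | hx
      · simp [h₁ x hx]
      · simp [h₂ (w - x) (by linarith)]
    simp [hz, ENNReal.ofReal_of_nonpos hw]
  · conv_lhs => rw [← Real.smul_map_volume_mul_right hw.ne']
    rw [lintegral_smul_measure, lintegral_map (by fun_prop) (by fun_prop), abs_of_pos hw,
      smul_eq_mul, ← lintegral_const_mul _ (by fun_prop)]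
    refine lintegral_congr fun z => ?_
    rw [mul_div_cancel_right₀ _ hw.ne', sub_mul, one_mul, mul_assoc, mul_assoc, mul_assoc]

lemma integrableOn_besselK_neg_one {x : ℝ} (hx : 0 < x) :
    IntegrableOn (fun u : ℝ => u ^ (-1 - 1 : ℝ) * Real.exp (-(x / 2) * (u + u⁻¹)))
      (Set.Ioi 0) := by
  refine Integrable.mono'
    ((exp_neg_integrableOn_Ioi 0 (half_pos hx)).const_mul (8 / x ^ 2)) (by fun_prop) ?_
  refine (ae_restrict_iff' measurableSet_Ioi).2 (Filter.Eventually.of_forall fun u hu => ?_)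
  have hu : 0 < u := hu
  have hq := Real.quadratic_le_exp_of_nonneg (x := x / 2 * u⁻¹) (by positivity)
  have hb : u⁻¹ ^ 2 ≤ 8 / x ^ 2 * Real.exp (x / 2 * u⁻¹) := by
    rw [div_mul_eq_mul_div, le_div_iff₀ (by positivity)]
    have : 0 ≤ x / 2 * u⁻¹ := by positivity
    nlinarith
  rw [Real.norm_of_nonneg (by positivity), show (-1 - 1 : ℝ) = -(2 : ℕ) by norm_num,
    Real.rpow_neg hu.le, Real.rpow_natCast, ← inv_pow, mul_add, Real.exp_add]
  calc u⁻¹ ^ 2 * (Real.exp (-(x / 2) * u) * Real.exp (-(x / 2) * u⁻¹))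
      ≤ 8 / x ^ 2 * Real.exp (x / 2 * u⁻¹) *
        (Real.exp (-(x / 2) * u) * Real.exp (-(x / 2) * u⁻¹)) := by gcongr
    _ = 8 / x ^ 2 * Real.exp (-(x / 2) * u) := by
      rw [neg_mul (x / 2) u⁻¹, Real.exp_neg (x / 2 * u⁻¹)]
      field_simp

lemma besselK_neg_one_pos {x : ℝ} (hx : 0 < x) : 0 < besselK (-1) x := by
  rw [besselK]
  refine mul_pos (by norm_num) ?_
  rw [setIntegral_pos_iff_support_of_nonneg_ae _ (integrableOn_besselK_neg_one hx)]
  · refine lt_of_lt_of_le ?_ (measure_mono (s := Set.Ioi 0) fun u hu => ⟨?_, hu⟩)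
    · simp
    · have hu : 0 < u := hu
      exact (mul_pos (Real.rpow_pos_of_pos hu _) (Real.exp_pos _)).ne'
  · refine (ae_restrict_iff' measurableSet_Ioi).2 (Filter.Eventually.of_forall fun u hu => ?_)
    have hu : 0 < u := hu
    simp only [Pi.zero_apply]
    positivity

@[fun_prop]
lemma measurable_besselK (ν : ℝ) : Measurable (besselK ν) := by
  unfold besselK
  refine Measurable.const_mul ?_ _
  refine StronglyMeasurable.measurable ?_
  refine StronglyMeasurable.integral_prod_right
    (f := fun x u : ℝ => u ^ (ν - 1) * Real.exp (-(x / 2) * (u + u⁻¹))) ?_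
  exact Measurable.stronglyMeasurable (by fun_prop)

@[fun_prop]
lemma measurable_zeta (μ : ℝ) : Measurable (zeta μ) := by
  unfold zeta
  fun_prop

@[fun_prop]
lemma measurable_igPdf (α : ℝ) : Measurable (igPdf α) := by
  unfold igPdf
  fun_prop

lemma one_add_sq_div_pos {μ z : ℝ} (hz : z ∈ Set.Ioo (0 : ℝ) 1) :
    0 < 1 + (z - μ) ^ 2 / (z * (1 - z)) := by
  have h0 : 0 < z := hz.1
  have h1 : 0 < 1 - z := sub_pos.2 hz.2
  positivity

lemma zeta_pos {μ z : ℝ} (hz : z ∈ Set.Ioo (0 : ℝ) 1) : 0 < zeta μ z :=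
  Real.sqrt_pos.2 (one_add_sq_div_pos hz)

lemma zeta_sq {μ z : ℝ} (hz : z ∈ Set.Ioo (0 : ℝ) 1) :
    zeta μ z ^ 2 = μ ^ 2 / z + (1 - μ) ^ 2 / (1 - z) := by
  have h0 : z ≠ 0 := hz.1.ne'
  have h1 : 1 - z ≠ 0 := (sub_pos.2 hz.2).ne'
  rw [zeta, Real.sq_sqrt (one_add_sq_div_pos hz).le]
  field_simp
  ring

/-- The density of `GIG(1, c², -1)` integrates to one. -/
lemma lintegral_gig_neg_one {c : ℝ} (hc : 0 < c) :
    ∫⁻ w : ℝ, ENNReal.ofReal (if 0 < w then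
      (c / (2 * besselK (-1) c)) * w ^ (-(2 : ℝ)) *
        Real.exp (-(1 / 2) * (c ^ 2 / w + w)) else 0) = 1 := by
  have hK := besselK_neg_one_pos hc
  set F : ℝ → ℝ := fun w => c / (2 * besselK (-1) c) * w ^ (-(2 : ℝ)) *
    Real.exp (-(1 / 2) * (c ^ 2 / w + w)) with hF
  have hscale : Set.EqOn (fun u => F (c * u)) (fun u => (c * (2 * besselK (-1) c))⁻¹ *
      (u ^ (-1 - 1 : ℝ) * Real.exp (-(c / 2) * (u + u⁻¹)))) (Set.Ioi 0) := by
    intro u hu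
    have hu : 0 < u := hu
    simp only [hF]
    rw [Real.mul_rpow hc.le hu.le, show (-1 - 1 : ℝ) = -2 by norm_num,
      show c ^ (-(2 : ℝ)) = (c ^ 2)⁻¹ by rw [Real.rpow_neg hc.le, Real.rpow_two],
      show -(1 / 2) * (c ^ 2 / (c * u) + c * u) = -(c / 2) * (u + u⁻¹) by field_simp; ring]
    field_simp
  have hFint : IntegrableOn F (Set.Ioi 0) := by
    have hcomp : IntegrableOn (fun u => F (c * u)) (Set.Ioi 0) :=
      IntegrableOn.congr_fun (Integrable.const_mul (integrableOn_besselK_neg_one hc) _)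
        hscale.symm measurableSet_Ioi
    simpa using (integrableOn_Ioi_comp_mul_left_iff F 0 hc).1 hcomp
  have hval : ∫ w in Set.Ioi 0, F w = 1 := by
    have h := integral_comp_mul_left_Ioi' F 0 hc
    rw [mul_zero] at h
    rw [← h, setIntegral_congr_fun measurableSet_Ioi hscale, integral_const_mul, smul_eq_mul,
      show ∫ u in Set.Ioi (0 : ℝ), u ^ (-1 - 1 : ℝ) * Real.exp (-(c / 2) * (u + u⁻¹)) =
        2 * besselK (-1) c by rw [besselK]; ring]
    field_simp
  have hind : (fun w : ℝ => ENNReal.ofReal (if 0 < w then F w else 0)) =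
      (Set.Ioi 0).indicator fun w => ENNReal.ofReal (F w) := by
    funext w
    by_cases hw : 0 < w <;> simp [hw]
  rw [hind, lintegral_indicator measurableSet_Ioi,
    ← ofReal_integral_eq_lintegral_ofReal hFint, hval, ENNReal.ofReal_one]
  refine (ae_restrict_iff' measurableSet_Ioi).2 (Filter.Eventually.of_forall fun w hw => ?_)
  have hw : 0 < w := hw
  simp only [Pi.zero_apply, hF]
  positivity

lemma igPdf_mul_igPdf {μ φ z w : ℝ} (hz : z ∈ Set.Ioo (0 : ℝ) 1) (hw : 0 < w) :
    w * (igPdf (μ * φ) (z * w) * igPdf ((1 - μ) * φ) ((1 - z) * w)) =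
      (μ * (1 - μ) * φ ^ 2 / (2 * Real.pi) * Real.exp φ * (z * (1 - z)) ^ (-(3 : ℝ) / 2)) *
        (w ^ (-(2 : ℝ)) *
          Real.exp (-(1 / 2) * (φ ^ 2 / w * (μ ^ 2 / z + (1 - μ) ^ 2 / (1 - z)) + w))) := by
  have h0 : 0 < z := hz.1
  have h1 : 0 < 1 - z := sub_pos.2 hz.2
  have hpow : w * (w ^ (-(3 : ℝ) / 2) * w ^ (-(3 : ℝ) / 2)) = w ^ (-(2 : ℝ)) := by
    rw [← Real.rpow_add hw, ← Real.rpow_one_add' hw.le (by norm_num)]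
    norm_num
  have hexp : Real.exp (-(1 / 2) * ((μ * φ) ^ 2 / (z * w) + z * w) + μ * φ) *
      Real.exp (-(1 / 2) * (((1 - μ) * φ) ^ 2 / ((1 - z) * w) + (1 - z) * w) + (1 - μ) * φ) =
      Real.exp φ *
        Real.exp (-(1 / 2) * (φ ^ 2 / w * (μ ^ 2 / z + (1 - μ) ^ 2 / (1 - z)) + w)) := by
    rw [← Real.exp_add, ← Real.exp_add]
    congr 1
    have := h1.ne'
    field_simp
    ring
  have hconst : μ * (1 - μ) * φ ^ 2 / (2 * Real.pi) =
      μ * φ / Real.sqrt (2 * Real.pi) * ((1 - μ) * φ / Real.sqrt (2 * Real.pi)) := by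
    rw [div_mul_div_comm, Real.mul_self_sqrt (by positivity)]
    ring
  simp only [igPdf]
  rw [Real.mul_rpow h0.le hw.le, Real.mul_rpow h1.le hw.le, Real.mul_rpow h0.le h1.le, ← hpow,
    hconst]
  linear_combination (μ * φ / Real.sqrt (2 * Real.pi) * ((1 - μ) * φ / Real.sqrt (2 * Real.pi)) *
    w * (z ^ (-(3 : ℝ) / 2) * w ^ (-(3 : ℝ) / 2)) *
    ((1 - z) ^ (-(3 : ℝ) / 2) * w ^ (-(3 : ℝ) / 2))) * hexp

/-- The conditional distribution of W = Y₁ + Y₂ given Z = Y₁/(Y₁+Y₂) is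
    GIG(1, φ² ζ_μ(z)², −1). -/
theorem condDistrib_W_given_Z
    {Ω : Type*} [MeasurableSpace Ω] [StandardBorelSpace Ω] [Nonempty Ω]
    (P : Measure Ω) [IsProbabilityMeasure P]
    (μ φ : ℝ) (hμ : μ ∈ Set.Ioo (0 : ℝ) 1) (hφ : 0 < φ)
    (Y₁ Y₂ : Ω → ℝ) (hY₁meas : Measurable Y₁) (hY₂meas : Measurable Y₂)
    (hY₁ : Measure.map Y₁ P =
      volume.withDensity fun y => ENNReal.ofReal (if 0 < y then igPdf (μ * φ) y else 0))
    (hY₂ : Measure.map Y₂ P =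
      volume.withDensity fun y =>
        ENNReal.ofReal (if 0 < y then igPdf ((1 - μ) * φ) y else 0))
    (hindep : IndepFun Y₁ Y₂ P)
    (Z W : Ω → ℝ)
    (hZ : Z = fun ω => Y₁ ω / (Y₁ ω + Y₂ ω))
    (hW : W = fun ω => Y₁ ω + Y₂ ω) :
    ∀ᵐ z ∂(Measure.map Z P),
      (condDistrib W Z P) z =
        volume.withDensity fun w =>
          ENNReal.ofReal
            (if 0 < w then
              (φ * zeta μ z / (2 * besselK (-1) (φ * zeta μ z))) * w ^ (-(2 : ℝ)) *
                Real.exp (-(1 / 2) *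
                  (φ ^ 2 / w * (μ ^ 2 / z + (1 - μ) ^ 2 / (1 - z)) + w))
            else 0) := by
  have hZm : Measurable Z := by rw [hZ]; fun_prop
  have hWm : Measurable W := by rw [hW]; fun_prop
  have hlt : MeasurableSet {y : ℝ | 0 < y} := measurableSet_Ioi
  have hf (α : ℝ) : Measurable fun y : ℝ =>
      ENNReal.ofReal (if 0 < y then igPdf α y else 0) :=
    (Measurable.ite hlt (by fun_prop) measurable_const).ennreal_ofReal
  have hpair : P.map (fun ω => (Z ω, W ω)) = (P.map fun ω => (Y₁ ω, Y₂ ω)).map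
      fun p : ℝ × ℝ => (p.1 / (p.1 + p.2), p.1 + p.2) := by
    rw [Measure.map_map (by fun_prop) (by fun_prop), hZ, hW]
    rfl
  rw [(indepFun_iff_map_prod_eq_prod_map_map hY₁meas.aemeasurable hY₂meas.aemeasurable).1 hindep,
    hY₁, hY₂, map_ratio_sum_withDensity (hf _) (hf _) (fun y hy => by simp [hy.not_gt])
      (fun y hy => by simp [hy.not_gt])] at hpair
  set A : ℝ → ENNReal := (Set.Ioo (0 : ℝ) 1).indicator fun z => ENNReal.ofReal
    (μ * (1 - μ) * φ ^ 2 / (2 * Real.pi) * Real.exp φ * (z * (1 - z)) ^ (-(3 : ℝ) / 2) /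
      (φ * zeta μ z / (2 * besselK (-1) (φ * zeta μ z)))) with hA
  have hAm : Measurable A := Measurable.indicator (by fun_prop) measurableSet_Ioo
  refine condDistrib_ae_eq_withDensity P hZm hWm hAm ?_ ?_ ?_
  · refine (Measurable.ite (measurable_snd hlt) ?_ measurable_const).ennreal_ofReal
    fun_prop
  · intro z hAz
    have hz : z ∈ Set.Ioo (0 : ℝ) 1 := Set.mem_of_indicator_ne_zero hAz
    rw [← lintegral_gig_neg_one (mul_pos hφ (zeta_pos (μ := μ) hz))]
    refine lintegral_congr fun w => ?_
    rw [← zeta_sq hz, mul_pow, mul_div_right_comm (φ ^ 2)]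
  · rw [hpair]
    congr 1
    funext ⟨z, w⟩
    dsimp only
    rcases le_or_gt w 0 with hw | hw
    · simp [ENNReal.ofReal_of_nonpos hw, hw.not_gt]
    by_cases hz : z ∈ Set.Ioo (0 : ℝ) 1
    · have h0 : 0 < z := hz.1
      have h1 : 0 < 1 - z := sub_pos.2 hz.2
      have hc : 0 < φ * zeta μ z := mul_pos hφ (zeta_pos hz)
      have hK := besselK_neg_one_pos hc
      have hμ0 : 0 < μ := hμ.1
      have hμ1 : 0 < 1 - μ := sub_pos.2 hμ.2
      have hg : 0 ≤ igPdf (μ * φ) (z * w) := by rw [igPdf]; positivity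
      rw [hA, Set.indicator_of_mem hz, if_pos hw, if_pos (mul_pos h0 hw),
        if_pos (mul_pos h1 hw), ← ENNReal.ofReal_mul hg, ← ENNReal.ofReal_mul hw.le,
        ← ENNReal.ofReal_mul (by positivity), igPdf_mul_igPdf hz hw]
      congr 1
      set d := φ * zeta μ z / (2 * besselK (-1) (φ * zeta μ z))
      have hd0 : d ≠ 0 := by positivity
      field_simp
    · rw [hA, Set.indicator_of_notMem hz]
      rcases le_or_gt z 0 with h0 | h0
      · simp [(mul_nonpos_of_nonpos_of_nonneg h0 hw.le).not_gt]
      · have h1 : 1 - z ≤ 0 := sub_nonpos.2 (not_lt.1 fun h => hz ⟨h0, h⟩)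
        simp [(mul_nonpos_of_nonpos_of_nonneg h1 hw.le).not_gt]
end

section
/- If Z ~ Bessel(μ, φ), then Var(Z) ≤ μ(1−μ)/2. -/
open MeasureTheory

/-- Mean-precision parameterized bessel density. -/
noncomputable def besselPdfMP (μ φ z : ℝ) : ℝ :=
  μ * (1 - μ) * φ * Real.exp φ / (Real.pi * (z * (1 - z)) ^ ((3 : ℝ) / 2)) *
    (besselK 1 (φ * zeta μ z) / zeta μ z)

open Set Filter Topology

/-- The integral of an even function against an odd weight `1 + k y / √(y² + c)` is unaffected by
the weight; transported along an injective map `T`, this bounds the integral of the pullback. -/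
lemma integrableOn_and_setIntegral_le_of_even {S : Set ℝ} (hS : MeasurableSet S)
    {T T' h f : ℝ → ℝ} {k c : ℝ} (hT : ∀ x ∈ S, HasDerivAt T (T' x) x) (hT' : ∀ x ∈ S, 0 ≤ T' x)
    (hinj : InjOn T S) (hh : Integrable h) (h0 : ∀ y, 0 ≤ h y) (heven : ∀ y, h (-y) = h y)
    (hk : |k| ≤ 1) (hc : 0 ≤ c)
    (hf : ∀ x ∈ S, f x = T' x * (h (T x) * (1 + k * (T x / √(T x ^ 2 + c))))) :
    IntegrableOn f S ∧ ∫ x in S, f x ≤ ∫ y, h y := by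
  set o : ℝ → ℝ := fun y ↦ k * (y / √(y ^ 2 + c)) with ho
  have ho1 : ∀ y, |o y| ≤ 1 := by
    intro y
    have h1 : |y| ≤ √(y ^ 2 + c) := by
      rw [← Real.sqrt_sq_eq_abs]; exact Real.sqrt_le_sqrt (by linarith)
    have h2 : |y / √(y ^ 2 + c)| ≤ 1 := by
      rw [abs_div, abs_of_nonneg (Real.sqrt_nonneg _)]
      exact div_le_one_of_le₀ h1 (Real.sqrt_nonneg _)
    simp only [ho, abs_mul]
    exact mul_le_one₀ hk (abs_nonneg _) h2
  have hom : Measurable o := by fun_prop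
  have hho : Integrable (fun y ↦ h y * o y) :=
    hh.mul_bdd (c := 1) hom.aestronglyMeasurable (ae_of_all _ ho1)
  have hodd : ∫ y, h y * o y = 0 := by
    have h1 := integral_neg_eq_self (fun y ↦ h y * o y) volume
    have h2 : ∀ y, h (-y) * o (-y) = -(h y * o y) := by
      intro y
      simp only [ho, heven, neg_sq]
      ring
    simp only [h2, integral_neg] at h1
    linarith
  have hH : Integrable (fun y ↦ h y * (1 + o y)) := by
    simp only [mul_add, mul_one]
    exact hh.add hho
  have hHint : ∫ y, h y * (1 + o y) = ∫ y, h y := by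
    simp only [mul_add, mul_one]
    rw [integral_add hh hho, hodd, add_zero]
  have hH0 : ∀ y, 0 ≤ h y * (1 + o y) := fun y ↦
    mul_nonneg (h0 y) (by linarith [neg_le_of_abs_le (ho1 y)])
  have hTw : ∀ x ∈ S, HasDerivWithinAt T (T' x) S x := fun x hx ↦ (hT x hx).hasDerivWithinAt
  have hfe : ∀ x ∈ S, |T' x| • (h (T x) * (1 + o (T x))) = f x := by
    intro x hx
    rw [hf x hx, abs_of_nonneg (hT' x hx), smul_eq_mul]
  constructor
  · exact ((integrableOn_image_iff_integrableOn_abs_deriv_smul hS hTw hinj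
      (fun y ↦ h y * (1 + o y))).1 hH.integrableOn).congr_fun hfe hS
  · rw [← hHint, ← setIntegral_congr_fun hS hfe,
      ← integral_image_eq_integral_abs_deriv_smul hS hTw hinj (fun y ↦ h y * (1 + o y))]
    exact setIntegral_le_integral hH (ae_of_all _ hH0)

/-- The modified Bessel integral of order `1/2`. -/
lemma integral_inv_sqrt_mul_exp_le {φ : ℝ} (hφ : 0 < φ) :
    IntegrableOn (fun s ↦ (√s)⁻¹ * Real.exp (-(φ / 2) * (s + s⁻¹))) (Ioi 0) ∧
    ∫ s in Ioi (0 : ℝ), (√s)⁻¹ * Real.exp (-(φ / 2) * (s + s⁻¹)) ≤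
      Real.exp (-φ) * √(2 * Real.pi / φ) := by
  have hd : ∀ s ∈ Ioi (0 : ℝ), HasDerivAt (fun s ↦ √s - (√s)⁻¹)
      ((s + 1) / (2 * s * √s)) s := by
    intro s hs
    have hs : 0 < s := hs
    have hq := Real.sqrt_pos.2 hs
    have h1 := Real.hasDerivAt_sqrt hs.ne'
    refine (h1.sub (h1.inv hq.ne')).congr_deriv ?_
    rw [Real.sq_sqrt hs.le]
    field_simp
    ring
  have hmono : StrictMonoOn (fun s ↦ √s - (√s)⁻¹) (Ioi 0) := by
    intro a ha b hb hab
    have ha : 0 < a := ha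
    have h1 := Real.sqrt_lt_sqrt ha.le hab
    have h2 := inv_strictAnti₀ (Real.sqrt_pos.2 ha) h1
    simp only
    linarith
  have key := integrableOn_and_setIntegral_le_of_even (k := 1) (c := 4)
    (h := fun t ↦ Real.exp (-φ) * Real.exp (-(φ / 2) * t ^ 2))
    (f := fun s ↦ (√s)⁻¹ * Real.exp (-(φ / 2) * (s + s⁻¹))) measurableSet_Ioi hd
    (fun s hs ↦ by have : 0 < s := hs; positivity) hmono.injOn
    ((integrable_exp_neg_mul_sq (half_pos hφ)).const_mul _) (fun t ↦ by positivity)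
    (fun t ↦ by simp) (by simp) (by norm_num) ?_
  · refine ⟨key.1, key.2.trans_eq ?_⟩
    rw [integral_const_mul, integral_gaussian]
    congr 2
    field_simp
  · intro s hs
    have hs : 0 < s := hs
    have hq := Real.sqrt_pos.2 hs
    obtain ⟨q, hq0, rfl⟩ : ∃ q : ℝ, 0 < q ∧ s = q ^ 2 := ⟨√s, hq, (Real.sq_sqrt hs.le).symm⟩
    simp only [Real.sqrt_sq hq0.le]
    have h1 : √((q - q⁻¹) ^ 2 + 4) = q + q⁻¹ := by
      rw [show (q - q⁻¹) ^ 2 + 4 = (q + q⁻¹) ^ 2 by field_simp; ring]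
      exact Real.sqrt_sq (by positivity)
    rw [h1, ← Real.exp_add, show -φ + -(φ / 2) * (q - q⁻¹) ^ 2 = -(φ / 2) * (q ^ 2 + (q ^ 2)⁻¹) by
      field_simp; ring]
    have h2 : q + q⁻¹ ≠ 0 := by positivity
    have h3 : q ^ 2 + 1 ≠ 0 := by positivity
    field_simp
    ring

/-- `besselKDiv φ (r ^ 2)` is `besselK 1 (φ * r) / r`. -/
noncomputable def besselKDiv (φ a : ℝ) : ℝ :=
  (1 / 2) * ∫ s in Ioi (0 : ℝ), Real.exp (-(φ / 2) * (a * s + s⁻¹))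

lemma besselKDiv_nonneg (φ a : ℝ) : 0 ≤ besselKDiv φ a :=
  mul_nonneg (by norm_num) (integral_nonneg fun _ ↦ (Real.exp_pos _).le)

lemma besselK_one_div (φ : ℝ) {r : ℝ} (hr : 0 < r) :
    besselK 1 (φ * r) / r = besselKDiv φ (r ^ 2) := by
  have h := integral_comp_mul_left_Ioi
    (fun u ↦ u ^ ((1 : ℝ) - 1) * Real.exp (-(φ * r / 2) * (u + u⁻¹))) 0 hr
  have h2 : ∀ s ∈ Ioi (0 : ℝ), (r * s) ^ ((1 : ℝ) - 1) *
      Real.exp (-(φ * r / 2) * (r * s + (r * s)⁻¹)) =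
      Real.exp (-(φ / 2) * (r ^ 2 * s + s⁻¹)) := by
    intro s hs
    have hs : 0 < s := hs
    rw [sub_self, Real.rpow_zero, one_mul]
    congr 1
    field_simp
  rw [setIntegral_congr_fun measurableSet_Ioi h2, mul_zero, smul_eq_mul] at h
  rw [besselKDiv, besselK, h]
  field_simp

lemma mul_besselKDiv (φ : ℝ) {a : ℝ} (ha : 0 < a) :
    a * besselKDiv φ a = (1 / 2) * ∫ t in Ioi (0 : ℝ), Real.exp (-(φ / 2) * (t + a * t⁻¹)) := by
  have h := integral_comp_mul_left_Ioi
    (fun t ↦ Real.exp (-(φ / 2) * (t + a * t⁻¹))) 0 ha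
  have h2 : ∀ s ∈ Ioi (0 : ℝ), Real.exp (-(φ / 2) * (a * s + a * (a * s)⁻¹)) =
      Real.exp (-(φ / 2) * (a * s + s⁻¹)) := by
    intro s hs
    have hs : 0 < s := hs
    congr 1
    field_simp
  rw [setIntegral_congr_fun measurableSet_Ioi h2, mul_zero, smul_eq_mul] at h
  rw [besselKDiv, h]
  field_simp

lemma antitoneOn_mul_besselKDiv {φ : ℝ} (hφ : 0 < φ) :
    AntitoneOn (fun a ↦ a * besselKDiv φ a) (Ioi 0) := by
  have hint : ∀ a : ℝ, 0 < a →
      IntegrableOn (fun t ↦ Real.exp (-(φ / 2) * (t + a * t⁻¹))) (Ioi 0) := by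
    intro a ha
    refine (exp_neg_integrableOn_Ioi 0 (half_pos hφ)).mono' (by fun_prop) ?_
    refine (ae_restrict_iff' measurableSet_Ioi).2 (ae_of_all _ fun t ht ↦ ?_)
    have ht : 0 < t := ht
    rw [Real.norm_eq_abs, Real.abs_exp, Real.exp_le_exp]
    have : 0 < φ / 2 * (a * t⁻¹) := by positivity
    linarith
  intro a ha b hb hab
  have ha : 0 < a := ha
  have hb : 0 < b := hb
  simp only
  rw [mul_besselKDiv φ ha, mul_besselKDiv φ hb]
  refine mul_le_mul_of_nonneg_left ?_ (by norm_num)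
  refine setIntegral_mono_on (hint b hb) (hint a ha) measurableSet_Ioi fun t ht ↦ ?_
  have ht : 0 < t := ht
  rw [Real.exp_le_exp]
  have : φ / 2 * (a * t⁻¹) ≤ φ / 2 * (b * t⁻¹) := by gcongr
  linarith

lemma integral_besselKDiv_le {φ : ℝ} (hφ : 0 < φ) :
    Integrable (fun y ↦ besselKDiv φ (1 + y ^ 2)) ∧
    ∫ y, besselKDiv φ (1 + y ^ 2) ≤ Real.pi * Real.exp (-φ) / φ := by
  set F : ℝ × ℝ → ℝ := fun p ↦ Real.exp (-(φ / 2) * ((1 + p.1 ^ 2) * p.2 + p.2⁻¹)) with hF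
  have hsplit : ∀ s y : ℝ, F (y, s) =
      Real.exp (-(φ / 2) * (s + s⁻¹)) * Real.exp (-(φ * s / 2) * y ^ 2) := by
    intro s y
    rw [← Real.exp_add]
    simp only [hF]
    congr 1
    ring
  have hin : ∀ s ∈ Ioi (0 : ℝ), ∫ y, F (y, s) =
      √(2 * Real.pi / φ) * ((√s)⁻¹ * Real.exp (-(φ / 2) * (s + s⁻¹))) := by
    intro s hs
    have hs : 0 < s := hs
    simp only [hsplit]
    rw [integral_const_mul, integral_gaussian,
      show Real.pi / (φ * s / 2) = (2 * Real.pi / φ) * s⁻¹ by field_simp,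
      Real.sqrt_mul (by positivity), Real.sqrt_inv]
    ring
  obtain ⟨hc1, hc2⟩ := integral_inv_sqrt_mul_exp_le hφ
  have hFint : Integrable F ((volume : Measure ℝ).prod (volume.restrict (Ioi 0))) := by
    have hm : Measurable F := by fun_prop
    rw [integrable_prod_iff' hm.aestronglyMeasurable]
    constructor
    · refine (ae_restrict_iff' measurableSet_Ioi).2 (ae_of_all _ fun s hs ↦ ?_)
      have hs : 0 < s := hs
      simp only [hsplit]
      exact (integrable_exp_neg_mul_sq (by positivity)).const_mul _
    · have : ∀ p, ‖F p‖ = F p := fun p ↦ by simp [hF]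
      simp only [this]
      exact IntegrableOn.congr_fun (hc1.const_mul _) (fun s hs ↦ (hin s hs).symm)
        measurableSet_Ioi
  have hG : (fun y ↦ besselKDiv φ (1 + y ^ 2)) =
      fun y ↦ (1 / 2) * ∫ s in Ioi (0 : ℝ), F (y, s) := rfl
  rw [hG]
  refine ⟨hFint.integral_prod_left.const_mul _, ?_⟩
  rw [integral_const_mul, integral_integral_swap (f := fun y s ↦ F (y, s)) hFint,
    setIntegral_congr_fun measurableSet_Ioi hin, integral_const_mul]
  calc (1 / 2) * (√(2 * Real.pi / φ) * _)
      ≤ (1 / 2) * (√(2 * Real.pi / φ) * (Real.exp (-φ) * √(2 * Real.pi / φ))) := by gcongr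
    _ = (1 / 2) * (Real.exp (-φ) * (√(2 * Real.pi / φ) * √(2 * Real.pi / φ))) := by ring
    _ = _ := by
      rw [Real.mul_self_sqrt (by positivity)]
      field_simp

lemma integral_sq_sub_one_div_sq :
    Integrable (fun y : ℝ ↦ (y ^ 2 - 1) / (1 + y ^ 2) ^ 2) ∧
    ∫ y : ℝ, (y ^ 2 - 1) / (1 + y ^ 2) ^ 2 = 0 := by
  have hint : Integrable (fun y : ℝ ↦ (y ^ 2 - 1) / (1 + y ^ 2) ^ 2) := by
    have hm : Measurable (fun y : ℝ ↦ (y ^ 2 - 1) / (1 + y ^ 2) ^ 2) := by fun_prop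
    refine integrable_inv_one_add_sq.mono' hm.aestronglyMeasurable (ae_of_all _ fun y ↦ ?_)
    rw [Real.norm_eq_abs, abs_div, abs_of_pos (by positivity : (0 : ℝ) < (1 + y ^ 2) ^ 2),
      div_le_iff₀ (by positivity), sq (1 + y ^ 2), inv_mul_cancel_left₀ (by positivity), abs_le]
    constructor <;> nlinarith [sq_nonneg y]
  refine ⟨hint, ?_⟩
  have hd : ∀ y : ℝ, HasDerivAt (fun y ↦ -(y / (1 + y ^ 2))) ((y ^ 2 - 1) / (1 + y ^ 2) ^ 2) y := by
    intro y
    have h1 : HasDerivAt (fun y : ℝ ↦ 1 + y ^ 2) (2 * y) y := by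
      simpa using (hasDerivAt_pow 2 y).const_add 1
    refine ((hasDerivAt_id y).div h1 (by positivity)).neg.congr_deriv ?_
    simp only [id]
    field_simp
    ring
  have hb : ∀ y : ℝ, ‖-(y / (1 + y ^ 2))‖ ≤ ‖y⁻¹‖ := by
    intro y
    rcases eq_or_ne y 0 with rfl | hy
    · simp
    rw [norm_neg, Real.norm_eq_abs, Real.norm_eq_abs, abs_div, abs_inv,
      abs_of_pos (by positivity : (0 : ℝ) < 1 + y ^ 2), div_le_iff₀ (by positivity),
      le_inv_mul_iff₀ (abs_pos.2 hy), abs_mul_abs_self]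
    nlinarith
  have ht := integral_of_hasDerivAt_of_tendsto hd hint
    (squeeze_zero_norm hb (by simpa using (tendsto_inv_atBot_zero (𝕜 := ℝ)).norm))
    (squeeze_zero_norm hb (by simpa using (tendsto_inv_atTop_zero (𝕜 := ℝ)).norm))
  simpa using ht

lemma integral_sq_div_mul_besselKDiv_le {φ : ℝ} (hφ : 0 < φ) :
    Integrable (fun y ↦ y ^ 2 / (1 + y ^ 2) * besselKDiv φ (1 + y ^ 2)) ∧
    ∫ y, y ^ 2 / (1 + y ^ 2) * besselKDiv φ (1 + y ^ 2) ≤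
      Real.pi * Real.exp (-φ) / φ / 2 := by
  obtain ⟨hG, hGle⟩ := integral_besselKDiv_le hφ
  obtain ⟨hr, hr0⟩ := integral_sq_sub_one_div_sq
  have hm : Measurable (fun y : ℝ ↦ y ^ 2 / (1 + y ^ 2)) := by fun_prop
  have hint : Integrable (fun y ↦ y ^ 2 / (1 + y ^ 2) * besselKDiv φ (1 + y ^ 2)) := by
    refine hG.bdd_mul (c := 1) hm.aestronglyMeasurable (ae_of_all _ fun y ↦ ?_)
    rw [Real.norm_eq_abs, abs_of_nonneg (by positivity)]
    exact div_le_one_of_le₀ (by linarith) (by positivity)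
  refine ⟨hint, ?_⟩
  have hpt : ∀ y : ℝ, y ^ 2 / (1 + y ^ 2) * besselKDiv φ (1 + y ^ 2) ≤
      (1 / 2) * besselKDiv φ (1 + y ^ 2) +
        (2 * besselKDiv φ 2 / 2) * ((y ^ 2 - 1) / (1 + y ^ 2) ^ 2) := by
    intro y
    have hanti := antitoneOn_mul_besselKDiv hφ
    have hp : (0 : ℝ) < 1 + y ^ 2 := by positivity
    have h2 : 0 ≤ (y ^ 2 - 1) *
        (2 * besselKDiv φ 2 - (1 + y ^ 2) * besselKDiv φ (1 + y ^ 2)) := by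
      rcases le_total (y ^ 2) 1 with h | h
      · have := hanti (mem_Ioi.2 hp) (mem_Ioi.2 two_pos) (by linarith)
        exact mul_nonneg_of_nonpos_of_nonpos (by linarith) (sub_nonpos.2 this)
      · have := hanti (mem_Ioi.2 two_pos) (mem_Ioi.2 hp) (by linarith)
        exact mul_nonneg (by linarith) (sub_nonneg.2 this)
    rw [← sub_nonneg]
    have e : (1 / 2) * besselKDiv φ (1 + y ^ 2) +
        (2 * besselKDiv φ 2 / 2) * ((y ^ 2 - 1) / (1 + y ^ 2) ^ 2) -
        y ^ 2 / (1 + y ^ 2) * besselKDiv φ (1 + y ^ 2) =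
        (y ^ 2 - 1) * (2 * besselKDiv φ 2 - (1 + y ^ 2) * besselKDiv φ (1 + y ^ 2)) /
          (2 * (1 + y ^ 2) ^ 2) := by
      field_simp
      ring
    rw [e]
    positivity
  calc _ ≤ ∫ y : ℝ, ((1 / 2) * besselKDiv φ (1 + y ^ 2) +
        (2 * besselKDiv φ 2 / 2) * ((y ^ 2 - 1) / (1 + y ^ 2) ^ 2)) :=
        integral_mono hint ((hG.const_mul _).add (hr.const_mul _)) hpt
    _ = (1 / 2) * ∫ y, besselKDiv φ (1 + y ^ 2) := by
        rw [integral_add (hG.const_mul _) (hr.const_mul _), integral_const_mul,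
          integral_const_mul, hr0, mul_zero, add_zero]
    _ ≤ _ := by linarith

/-- If Z ~ Bessel(μ, φ), then Var(Z) ≤ μ(1−μ)/2. -/
theorem bessel_variance_le (μ φ : ℝ) (hμ : μ ∈ Set.Ioo (0 : ℝ) 1) (hφ : 0 < φ) :
    ∫ z in Set.Ioo (0 : ℝ) 1, (z - μ) ^ 2 * besselPdfMP μ φ z ≤ μ * (1 - μ) / 2 := by
  obtain ⟨hμ0, hμ1⟩ := hμ
  have hm : 0 < μ * (1 - μ) := mul_pos hμ0 (by linarith)
  set C : ℝ := μ * (1 - μ) * φ * Real.exp φ / Real.pi with hC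
  have hC0 : 0 ≤ C := by positivity
  have hD : ∀ z ∈ Ioo (0 : ℝ) 1, 0 < z * (1 - 2 * μ) + μ := by
    rintro z ⟨h0, h1⟩
    nlinarith [mul_pos h0 (sub_pos.2 hμ1), mul_pos hμ0 (sub_pos.2 h1)]
  have hd : ∀ z ∈ Ioo (0 : ℝ) 1, HasDerivAt (fun z ↦ (z - μ) / √(z * (1 - z)))
      ((z * (1 - 2 * μ) + μ) / (2 * (z * (1 - z) * √(z * (1 - z))))) z := by
    rintro z ⟨h0, h1⟩
    have hw : 0 < z * (1 - z) := mul_pos h0 (by linarith)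
    have hq := Real.sqrt_pos.2 hw
    have e1 : HasDerivAt (fun z : ℝ ↦ z * (1 - z)) (1 - 2 * z) z :=
      ((hasDerivAt_id z).mul ((hasDerivAt_id z).const_sub 1)).congr_deriv (by simp; ring)
    refine (((hasDerivAt_id z).sub_const μ).div (e1.sqrt hw.ne') hq.ne').congr_deriv ?_
    have hsq := Real.sq_sqrt hw.le
    simp only [id]
    generalize √(z * (1 - z)) = q at *
    rw [← hsq]
    field_simp
    rw [hsq]
    ring
  have hmono : StrictMonoOn (fun z ↦ (z - μ) / √(z * (1 - z))) (Ioo 0 1) := by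
    refine strictMonoOn_of_deriv_pos (convex_Ioo 0 1)
      (fun z hz ↦ (hd z hz).continuousAt.continuousWithinAt) fun z hz ↦ ?_
    rw [interior_Ioo] at hz
    have hw : 0 < z * (1 - z) := mul_pos hz.1 (by linarith [hz.2])
    rw [(hd z hz).deriv]
    have := hD z hz
    positivity
  obtain ⟨hint, hle⟩ := integral_sq_div_mul_besselKDiv_le hφ
  have key := integrableOn_and_setIntegral_le_of_even (k := 1 - 2 * μ) (c := 4 * (μ * (1 - μ)))
    (h := fun y ↦ C * (y ^ 2 / (1 + y ^ 2) * besselKDiv φ (1 + y ^ 2)))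
    (f := fun z ↦ (z - μ) ^ 2 * besselPdfMP μ φ z) measurableSet_Ioo hd
    (fun z hz ↦ by
      have := hD z hz
      have hw : 0 < z * (1 - z) := mul_pos hz.1 (by linarith [hz.2])
      positivity) hmono.injOn
    (hint.const_mul _)
    (fun y ↦ mul_nonneg hC0 (mul_nonneg (by positivity) (besselKDiv_nonneg _ _)))
    (fun y ↦ by simp) (by rw [abs_le]; constructor <;> linarith) (by positivity) ?_
  · refine key.2.trans ?_
    rw [integral_const_mul]
    refine (mul_le_mul_of_nonneg_left hle hC0).trans_eq ?_
    rw [hC, Real.exp_neg]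
    field_simp
  · rintro z ⟨h0, h1⟩
    have hw : 0 < z * (1 - z) := mul_pos h0 (by linarith)
    have hq := Real.sqrt_pos.2 hw
    have hsq := Real.sq_sqrt hw.le
    have hDz := hD z ⟨h0, h1⟩
    have hζ : 0 < zeta μ z := Real.sqrt_pos.2 (by positivity)
    have hζ2 : zeta μ z ^ 2 = 1 + (z - μ) ^ 2 / (z * (1 - z)) := Real.sq_sqrt (by positivity)
    have hpow : (z * (1 - z)) ^ ((3 : ℝ) / 2) = z * (1 - z) * √(z * (1 - z)) := by
      rw [show (3 : ℝ) / 2 = 1 + 1 / 2 by norm_num, Real.rpow_add hw, Real.rpow_one,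
        Real.sqrt_eq_rpow]
    have hroot : √(((z - μ) / √(z * (1 - z))) ^ 2 + 4 * (μ * (1 - μ))) =
        (z * (1 - 2 * μ) + μ) / √(z * (1 - z)) := by
      rw [← Real.sqrt_sq (div_pos hDz hq).le]
      congr 1
      rw [div_pow, div_pow, hsq]
      have : 1 - z ≠ 0 := by linarith
      field_simp
      ring
    have hN : 0 < z * (1 - z) + (z - μ) ^ 2 := by positivity
    rw [hroot, div_pow, hsq, besselPdfMP, besselK_one_div φ hζ, hζ2, hpow]
    have hodd : 1 + (1 - 2 * μ) * ((z - μ) / √(z * (1 - z)) /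
        ((z * (1 - 2 * μ) + μ) / √(z * (1 - z)))) =
        2 * (z * (1 - z) + (z - μ) ^ 2) / (z * (1 - 2 * μ) + μ) := by
      rw [div_div_div_cancel_right₀ hq.ne', eq_div_iff hDz.ne', add_mul, mul_assoc,
        div_mul_cancel₀ _ hDz.ne']
      ring
    have heven : (z - μ) ^ 2 / (z * (1 - z)) / (1 + (z - μ) ^ 2 / (z * (1 - z))) =
        (z - μ) ^ 2 / (z * (1 - z) + (z - μ) ^ 2) := by
      generalize z * (1 - z) = w at *
      have : 1 + (z - μ) ^ 2 / w = (w + (z - μ) ^ 2) / w := by field_simp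
      rw [this, div_div_div_cancel_right₀ hw.ne']
    rw [hodd, heven, hC]
    generalize besselKDiv φ _ = G
    generalize √(z * (1 - z)) = q at *
    generalize z * (1 - z) = w at *
    generalize z * (1 - 2 * μ) + μ = D at *
    field_simp
end
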